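/- The Wendland function w₂(t) = (1 − |t|)₊⁴ (4|t| + 1), where (x)₊ = max(x, 0), is a positive-definite function on ℝ. -/

import Mathlib

open MeasureTheory Set

/-- the truncated parabola of half-width `a` -/
noncomputable def wpar (a x : ℝ) : ℝ := max (a ^ 2 - x ^ 2) 0

lemma wpar_cont (a : ℝ) : Continuous (wpar a) := by
  unfold wpar; fun_prop

lemma wpar_zero {a x : ℝ} (ha : 0 ≤ a) (h : a ≤ |x|) : wpar a x = 0 := by
  unfold wpar
  apply max_eq_right
  have := pow_le_pow_left₀ ha h 2
  rw [sq_abs] at this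
  linarith

lemma wpar_eq {a x : ℝ} (h : |x| ≤ a) : wpar a x = a ^ 2 - x ^ 2 := by
  unfold wpar
  apply max_eq_left
  have := pow_le_pow_left₀ (abs_nonneg x) h 2
  rw [sq_abs] at this
  linarith

lemma wpar_prod_eq {a : ℝ} (ha : 0 < a) {u v : ℝ} (huv : u ≤ v) (x : ℝ) :
    wpar a (x - u) * wpar a (x - v) = (Ioc (v - a) (u + a)).indicator
      (fun x => (a ^ 2 - (x - u) ^ 2) * (a ^ 2 - (x - v) ^ 2)) x := by
  by_cases hx : x ∈ Ioc (v - a) (u + a)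
  · rw [indicator_of_mem hx, wpar_eq, wpar_eq]
    · rw [abs_le]; constructor <;> linarith [hx.1, hx.2]
    · rw [abs_le]; constructor <;> linarith [hx.1, hx.2]
  · rw [indicator_of_notMem hx]
    rw [mem_Ioc, not_and_or, not_lt, not_le] at hx
    rcases hx with hx | hx
    · rw [wpar_zero ha.le (x := x - v), mul_zero]
      rw [le_abs]; right; linarith
    · rw [wpar_zero ha.le (x := x - u), zero_mul]
      rw [le_abs]; left; linarith

lemma wpar_prod_integrable {a : ℝ} (ha : 0 < a) (u v : ℝ) :
    Integrable (fun x => wpar a (x - u) * wpar a (x - v)) := by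
  wlog huv : u ≤ v generalizing u v
  · have := this v u (le_of_not_ge huv)
    simpa only [mul_comm] using this
  simp_rw [wpar_prod_eq ha huv]
  rw [integrable_indicator_iff measurableSet_Ioc]
  apply Continuous.integrableOn_Ioc
  fun_prop

/-- the slice kernel -/
noncomputable def wG (t s : ℝ) : ℝ := (Ioc |t| 1).indicator
  (fun s => 4 * (s ^ 3 - 5 * t ^ 2 * s + 5 * |t| ^ 3 - |t| ^ 5 / s ^ 2)) s

lemma wpar_prod_integral {s : ℝ} (hs : 0 < s) (hs1 : s ≤ 1) (u v : ℝ) :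
    wG (v - u) s = 120 / s ^ 2 * ∫ x, wpar (s / 2) (x - u) * wpar (s / 2) (x - v) := by
  wlog huv : u ≤ v generalizing u v
  · have := this v u (le_of_not_ge huv)
    have e : wG (v - u) s = wG (u - v) s := by
      unfold wG
      rw [abs_sub_comm v u, show (v - u) ^ 2 = (u - v) ^ 2 by ring]
    rw [e, this]
    simp only [mul_comm]
  have ha : 0 < s / 2 := by positivity
  simp_rw [wpar_prod_eq ha huv]
  rw [integral_indicator measurableSet_Ioc]
  unfold wG
  rw [abs_of_nonneg (sub_nonneg.2 huv)]
  by_cases h : v - u < s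
  · have hm : s ∈ Ioc (v - u) 1 := ⟨h, hs1⟩
    rw [indicator_of_mem hm]
    rw [← intervalIntegral.integral_of_le (by linarith)]
    rw [intervalIntegral.integral_eq_sub_of_hasDerivAt
      (f := fun x => (s/2)^2*((s/2)^2-(v-u)^2)*(x-u) + (s/2)^2*(v-u)*(x-u)^2
        - (2*(s/2)^2-(v-u)^2)/3*(x-u)^3 - (v-u)/2*(x-u)^4 + (1/5)*(x-u)^5)]
    · field_simp
      ring
    · intro x _
      have h1 : HasDerivAt (fun x : ℝ => x - u) 1 x := (hasDerivAt_id x).sub_const u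
      refine HasDerivAt.congr_deriv (((((h1.const_mul ((s/2)^2*((s/2)^2-(v-u)^2))).add
        ((h1.pow 2).const_mul ((s/2)^2*(v-u)))).sub
        ((h1.pow 3).const_mul ((2*(s/2)^2-(v-u)^2)/3))).sub
        ((h1.pow 4).const_mul ((v-u)/2))).add ((h1.pow 5).const_mul (1/5))) ?_
      push_cast
      ring
    · apply Continuous.intervalIntegrable
      fun_prop
  · rw [indicator_of_notMem (fun hh => h hh.1), Ioc_eq_empty (by linarith)]
    simp

lemma wG_sum_nonneg (n : ℕ) (t c : Fin n → ℝ) (s : ℝ) :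
    0 ≤ ∑ i, ∑ j, c i * c j * wG (t j - t i) s := by
  by_cases h : 0 < s ∧ s ≤ 1
  · obtain ⟨hs, hs1⟩ := h
    have ha : 0 < s / 2 := by positivity
    have key : ∑ i, ∑ j, c i * c j * wG (t j - t i) s
        = 120 / s ^ 2 * ∫ x, (∑ i, c i * wpar (s / 2) (x - t i)) ^ 2 := by
      have e : ∀ x, (∑ i, c i * wpar (s / 2) (x - t i)) ^ 2
          = ∑ i, ∑ j, c i * c j * (wpar (s / 2) (x - t i) * wpar (s / 2) (x - t j)) := by
        intro x
        rw [sq, Finset.sum_mul_sum]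
        refine Finset.sum_congr rfl fun i _ => Finset.sum_congr rfl fun j _ => by ring
      simp_rw [e]
      have hi := fun i j => (wpar_prod_integrable ha (t i) (t j)).const_mul (c i * c j)
      rw [integral_finsetSum _ fun i _ => integrable_finsetSum _ fun j _ => hi i j,
        Finset.mul_sum]
      refine Finset.sum_congr rfl fun i _ => ?_
      rw [integral_finsetSum _ fun j _ => hi i j, Finset.mul_sum]
      refine Finset.sum_congr rfl fun j _ => ?_
      rw [integral_const_mul, wpar_prod_integral hs hs1]
      ring
    rw [key]
    exact mul_nonneg (by positivity) (integral_nonneg fun x => sq_nonneg _)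
  · have z : ∀ r, wG r s = 0 := fun r => by
      unfold wG
      apply indicator_of_notMem
      exact fun hh => h ⟨(abs_nonneg r).trans_lt hh.1, hh.2⟩
    simp [z]

lemma wG_integral (t : ℝ) : Integrable (wG t) ∧
    ∫ s, wG t s = (max (1 - |t|) 0) ^ 4 * (4 * |t| + 1) := by
  unfold wG
  rw [integrable_indicator_iff measurableSet_Ioc, integral_indicator measurableSet_Ioc]
  rcases eq_or_ne t 0 with rfl | ht
  · constructor
    · apply Continuous.integrableOn_Ioc
      simp
      fun_prop
    · rw [← intervalIntegral.integral_of_le (by simp)]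
      simp
      norm_num
  have hp : 0 < |t| := abs_pos.2 ht
  rw [← sq_abs t]
  generalize |t| = r at *
  rcases le_or_gt 1 r with h | h
  · rw [Ioc_eq_empty (by linarith), max_eq_right (by linarith)]
    simp
  have hI : IntervalIntegrable
      (fun s => 4 * (s ^ 3 - 5 * r ^ 2 * s + 5 * r ^ 3 - r ^ 5 / s ^ 2)) volume r 1 := by
    apply ContinuousOn.intervalIntegrable
    rw [uIcc_of_le h.le]
    have : ∀ s ∈ Icc r 1, s ^ 2 ≠ 0 := fun s hs => by
      have : 0 < s := hp.trans_le hs.1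
      positivity
    fun_prop (disch := assumption)
  refine ⟨(intervalIntegrable_iff_integrableOn_Ioc_of_le h.le).1 hI, ?_⟩
  rw [← intervalIntegral.integral_of_le h.le, max_eq_left (by linarith)]
  rw [intervalIntegral.integral_eq_sub_of_hasDerivAt
    (f := fun s => s ^ 4 - 10 * r ^ 2 * s ^ 2 + 20 * r ^ 3 * s + 4 * r ^ 5 * s⁻¹) _ hI]
  · field_simp
    ring
  · intro s hs
    rw [uIcc_of_le h.le] at hs
    have hs0 : s ≠ 0 := (hp.trans_le hs.1).ne'
    have h1 := hasDerivAt_id s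
    refine HasDerivAt.congr_deriv ((((h1.pow 4).sub ((h1.pow 2).const_mul (10 * r ^ 2))).add
      (h1.const_mul (20 * r ^ 3))).add ((hasDerivAt_inv hs0).const_mul (4 * r ^ 5))) ?_
    simp only [id]
    field_simp
    push_cast
    ring

theorem wendland_w2_posdef :
    ∀ (n : ℕ) (t : Fin n → ℝ) (c : Fin n → ℝ),
      0 ≤ ∑ i, ∑ j,
        c i * c j *
          ((max (1 - |t j - t i|) 0) ^ 4 * (4 * |t j - t i| + 1)) := by
  intro n t c
  have hi := fun i j => (wG_integral (t j - t i)).1.const_mul (c i * c j)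
  have key : ∑ i, ∑ j, c i * c j *
      ((max (1 - |t j - t i|) 0) ^ 4 * (4 * |t j - t i| + 1))
      = ∫ s, ∑ i, ∑ j, c i * c j * wG (t j - t i) s := by
    rw [integral_finsetSum _ fun i _ => integrable_finsetSum _ fun j _ => hi i j]
    refine Finset.sum_congr rfl fun i _ => ?_
    rw [integral_finsetSum _ fun j _ => hi i j]
    refine Finset.sum_congr rfl fun j _ => ?_
    rw [integral_const_mul, (wG_integral _).2]
  rw [key]
  exact integral_nonneg fun s => wG_sum_nonneg n t c s
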